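/- Let 0 ≤ e ≤ h−1, let C_1,…,C_s ⊆ F_q^n be linear codes, and let A be a non-singular s×s Toeplitz matrix over F_q. Let M_{τ'} be an n×n monomial matrix, D an s×s invertible diagonal matrix over F_q, σ' = (M_{τ'}, e), and σ = (M_τ, e) with M_τ = D ⊗ M_{τ'}. If C_i ⊆ C_{s+1−i}^{⊥σ'} for every 1 ≤ i ≤ s, then [C_1,…,C_s]·(π_e(A)^{-1}·Q·D^{-1}) ⊆ C(A)^{⊥σ}, where C(A) = [C_1,…,C_s]·A. Moreover, if in addition π_e(A)·A = Q·D^{-1}, then C(A) is σ self-orthogonal. -/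

import Mathlib

open Matrix Finset Kronecker

variable {F : Type} [Field F] [DecidableEq F]

/-- Entrywise application of the map `π_e : x ↦ x ^ (p ^ e)` to a matrix. -/
def piE (p e : ℕ) {m n : Type} (A : Matrix m n F) : Matrix m n F :=
  A.map fun x => x ^ p ^ e

/-- Entrywise application of `π_e` to a vector. -/
def piEv (p e : ℕ) {n : Type} (v : n → F) : n → F := fun i => v i ^ p ^ e

/-- A monomial matrix: exactly one nonzero entry in each row and each column. -/
def IsMonomial {n : Type} [Fintype n] (M : Matrix n n F) : Prop :=
  (∀ i, ∃! j, M i j ≠ 0) ∧ (∀ j, ∃! i, M i j ≠ 0)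

/-- Non-singular by columns (NSC): for each `ℓ`, every `ℓ × ℓ` submatrix formed by the first
`ℓ` rows and any `ℓ` columns (in increasing order) is non-singular. -/
def IsNSC {s : ℕ} (A : Matrix (Fin s) (Fin s) F) : Prop :=
  ∀ (ℓ : ℕ) (hℓ : ℓ ≤ s) (j : Fin ℓ → Fin s), StrictMono j →
    (Matrix.of fun a b : Fin ℓ => A (Fin.castLE hℓ a) (j b)).det ≠ 0

/-- Toeplitz matrix: constant along diagonals. -/
def IsToeplitz {s : ℕ} (A : Matrix (Fin s) (Fin s) F) : Prop :=
  ∀ (i j : ℕ) (hi : i + 1 < s) (hj : j + 1 < s),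
    A ⟨i, Nat.lt_of_succ_lt hi⟩ ⟨j, Nat.lt_of_succ_lt hj⟩ = A ⟨i + 1, hi⟩ ⟨j + 1, hj⟩

/-- The anti-diagonal matrix `Q` with ones on the anti-diagonal. -/
def antiDiagQ (F : Type) [Field F] (s : ℕ) : Matrix (Fin s) (Fin s) F :=
  Matrix.of fun i j => if (i : ℕ) + (j : ℕ) + 1 = s then 1 else 0

/-- Dual of a code with respect to the pairing `⟨u, c⟩ = ∑ j, u j * g c j`. -/
def dualWith {n : Type} [Fintype n] (g : (n → F) → n → F) (C : Submodule F (n → F)) :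
    Submodule F (n → F) where
  carrier := {u | ∀ c ∈ C, ∑ j, u j * g c j = 0}
  add_mem' := by
    intro a b ha hb c hc
    simp only [Pi.add_apply, add_mul, Finset.sum_add_distrib, ha c hc, hb c hc, add_zero]
  zero_mem' := by
    intro c hc
    simp
  smul_mem' := by
    intro r a ha c hc
    simp only [Pi.smul_apply, smul_eq_mul, mul_assoc, ← Finset.mul_sum, ha c hc, mul_zero]

/-- The `σ = (M, e)` dual of a linear code. -/
def sigmaDual {n : Type} [Fintype n] (p e : ℕ) (M : Matrix n n F)
    (C : Submodule F (n → F)) : Submodule F (n → F) :=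
  dualWith (fun c => Matrix.vecMul (piEv p e c) M) C

/-- The Euclidean dual of a linear code. -/
def euclidDual {n : Type} [Fintype n] (C : Submodule F (n → F)) : Submodule F (n → F) :=
  dualWith id C

/-- The matrix-product code `[C_1, …, C_s] · A`, realized inside `Fin s × Fin n → F`
(block `j` of a codeword is `∑ i, A i j • c i`). -/
def matrixProductCode {n s : ℕ} (C : Fin s → Submodule F (Fin n → F))
    (A : Matrix (Fin s) (Fin s) F) : Submodule F (Fin s × Fin n → F) where
  carrier := {x | ∃ c : Fin s → Fin n → F, (∀ i, c i ∈ C i) ∧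
    ∀ jt : Fin s × Fin n, x jt = ∑ i, A i jt.1 * c i jt.2}
  add_mem' := by
    rintro x y ⟨c, hc, hx⟩ ⟨d, hd, hy⟩
    refine ⟨c + d, fun i => (C i).add_mem (hc i) (hd i), fun jt => ?_⟩
    simp [hx jt, hy jt, mul_add, Finset.sum_add_distrib]
  zero_mem' := ⟨0, fun i => (C i).zero_mem, fun jt => by simp⟩
  smul_mem' := by
    rintro r x ⟨c, hc, hx⟩
    refine ⟨r • c, fun i => (C i).smul_mem r (hc i), fun jt => ?_⟩
    simp [hx jt, Finset.mul_sum, mul_left_comm]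

/-- The minimum distance of the code `C` is at least `d`. -/
def minDistGe {n : Type} [Fintype n] (C : Submodule F (n → F)) (d : ℕ) : Prop :=
  ∀ x ∈ C, x ≠ 0 → d ≤ hammingNorm x

/-- The code `C` has minimum distance exactly `d`. -/
def minDistEq {n : Type} [Fintype n] (C : Submodule F (n → F)) (d : ℕ) : Prop :=
  minDistGe C d ∧ ∃ x ∈ C, x ≠ 0 ∧ hammingNorm x = d

theorem antiDiagQ_apply {F : Type} [Field F] {s : ℕ} (i j : Fin s) :
    antiDiagQ F s i j = if j = i.rev then 1 else 0 := by
  have : ((i : ℕ) + (j : ℕ) + 1 = s) ↔ j = i.rev := by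
    rw [Fin.ext_iff, Fin.val_rev]
    omega
  simp [antiDiagQ, this]

theorem antiDiagQ_mul_apply {F : Type} [Field F] {s : ℕ} (X : Matrix (Fin s) (Fin s) F)
    (i j : Fin s) : (antiDiagQ F s * X) i j = X i.rev j := by
  simp [Matrix.mul_apply, antiDiagQ_apply]

theorem mul_antiDiagQ_apply {F : Type} [Field F] {s : ℕ} (X : Matrix (Fin s) (Fin s) F)
    (i j : Fin s) : (X * antiDiagQ F s) i j = X i j.rev := by
  have (k : Fin s) : j = k.rev ↔ k = j.rev := by rw [eq_comm, Fin.rev_eq_iff]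
  simp [Matrix.mul_apply, antiDiagQ_apply, this]

theorem IsToeplitz.apply_add {F : Type} {s : ℕ} [Field F] {A : Matrix (Fin s) (Fin s) F}
    (hA : IsToeplitz A) (i j m : ℕ) (hi : i + m < s) (hj : j + m < s) :
    A ⟨i + m, hi⟩ ⟨j + m, hj⟩ = A ⟨i, by omega⟩ ⟨j, by omega⟩ := by
  induction m with
  | zero => rfl
  | succ m ih => exact (hA (i + m) (j + m) hi hj).symm.trans (ih (by omega) (by omega))

theorem IsToeplitz.apply_eq {F : Type} {s : ℕ} [Field F] {A : Matrix (Fin s) (Fin s) F}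
    (hA : IsToeplitz A) {i j k l : Fin s} (h : (i : ℕ) + l = k + j) : A i j = A k l := by
  wlog hik : (i : ℕ) ≤ k generalizing i j k l
  · exact (this h.symm (by omega)).symm
  have hk : k = ⟨i + (k - i : ℕ), by omega⟩ := Fin.ext (by simp only; omega)
  have hl : l = ⟨j + (k - i : ℕ), by omega⟩ := Fin.ext (by simp only; omega)
  exact ((congrArg₂ A hk hl).trans (hA.apply_add i j _ _ _)).symm

theorem IsToeplitz.antiDiagQ_mul_transpose {F : Type} {s : ℕ} [Field F]
    {A : Matrix (Fin s) (Fin s) F} (hA : IsToeplitz A) :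
    antiDiagQ F s * Aᵀ = A * antiDiagQ F s := by
  ext i j
  rw [antiDiagQ_mul_apply, mul_antiDiagQ_apply, Matrix.transpose_apply]
  apply hA.apply_eq
  simp only [Fin.val_rev]
  omega

theorem IsToeplitz.piE {F : Type} {s : ℕ} [Field F] {A : Matrix (Fin s) (Fin s) F}
    (hA : IsToeplitz A) (p e : ℕ) : IsToeplitz (piE p e A) := fun i j hi hj =>
  congrArg (· ^ p ^ e) (hA i j hi hj)

theorem isUnit_det_piE {F : Type} [Field F] (p e : ℕ) [ExpChar F p] {s : ℕ}
    {A : Matrix (Fin s) (Fin s) F} (hA : IsUnit A.det) : IsUnit (piE p e A).det := by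
  have h : piE p e A = (iterateFrobenius F p e).mapMatrix A := by
    ext i j
    simp [piE, iterateFrobenius_def]
  rw [h, ← RingHom.map_det]
  exact hA.map _

theorem vecMul_piEv_kronecker {F : Type} [Field F] (p e : ℕ) [ExpChar F p] {n s : ℕ}
    (A : Matrix (Fin s) (Fin s) F) (M : Matrix (Fin n) (Fin n) F) (D : Fin s → F)
    (d : Fin s → Fin n → F) (y : Fin s × Fin n → F)
    (hy : ∀ jt : Fin s × Fin n, y jt = ∑ k, A k jt.1 * d k jt.2) (j : Fin s) (t : Fin n) :
    Matrix.vecMul (piEv p e y) (Matrix.diagonal D ⊗ₖ M) (j, t) =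
      ∑ k, D j * piE p e A k j * Matrix.vecMul (piEv p e (d k)) M t := by
  have hpow (j : Fin s) (t : Fin n) :
      piEv p e y (j, t) = ∑ k, piE p e A k j * piEv p e (d k) t := by
    simp only [piEv, piE, Matrix.map_apply, hy, sum_pow_char_pow, mul_pow]
  simp only [Matrix.vecMul, dotProduct, Fintype.sum_prod_type, Matrix.kroneckerMap_apply,
    Matrix.diagonal_apply, ite_mul, zero_mul, mul_ite, mul_zero, hpow, Finset.mul_sum]
  rw [Finset.sum_comm]
  simp only [Finset.sum_ite_eq', Finset.mem_univ, if_true, Finset.sum_mul]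
  rw [Finset.sum_comm]
  exact Finset.sum_congr rfl fun k _ => Finset.sum_congr rfl fun t' _ => by ring

/-- If `B · D · π_e(A)ᵀ` is the anti-diagonal matrix, only the pairings of `C_i` with
`C_{s+1-i}` contribute to the pairing of `[C_1, …, C_s]·B` with `[C_1, …, C_s]·A`. -/
theorem matrixProductCode_le_sigmaDual {F : Type} [Field F] (p e : ℕ) [ExpChar F p] {n s : ℕ}
    (C : Fin s → Submodule F (Fin n → F)) (A B : Matrix (Fin s) (Fin s) F)
    (M : Matrix (Fin n) (Fin n) F) (D : Fin s → F)
    (hC : ∀ i : Fin s, C i ≤ sigmaDual p e M (C i.rev))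
    (hB : B * Matrix.diagonal D * (piE p e A)ᵀ = antiDiagQ F s) :
    matrixProductCode C B ≤
      sigmaDual p e (Matrix.diagonal D ⊗ₖ M) (matrixProductCode C A) := by
  rintro x ⟨c, hc, hx⟩ y ⟨d, hd, hy⟩
  have hpair (i : Fin s) : ∑ t, c i t * Matrix.vecMul (piEv p e (d i.rev)) M t = 0 :=
    hC i (hc i) _ (hd i.rev)
  have hentry (i k : Fin s) :
      ∑ j, B i j * D j * piE p e A k j = if k = i.rev then 1 else 0 := by
    rw [← antiDiagQ_apply, ← hB, Matrix.mul_apply]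
    simp [Matrix.mul_diagonal]
  calc ∑ jt, x jt * Matrix.vecMul (piEv p e y) (Matrix.diagonal D ⊗ₖ M) jt
      = ∑ j, ∑ t, ∑ i, ∑ k, B i j * D j * piE p e A k j *
          (c i t * Matrix.vecMul (piEv p e (d k)) M t) := by
        rw [Fintype.sum_prod_type]
        refine Finset.sum_congr rfl fun j _ => Finset.sum_congr rfl fun t _ => ?_
        rw [vecMul_piEv_kronecker p e A M D d y hy, hx, Finset.sum_mul_sum]
        exact Finset.sum_congr rfl fun i _ => Finset.sum_congr rfl fun k _ => by ring
    _ = ∑ i, ∑ k, (∑ j, B i j * D j * piE p e A k j) *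
          ∑ t, c i t * Matrix.vecMul (piEv p e (d k)) M t := by
        simp only [Finset.sum_mul_sum]
        simp only [← Finset.sum_product']
        refine Finset.sum_nbij' (fun z => (z.2.2.1, z.2.2.2, z.1, z.2.1))
          (fun z => (z.2.2.1, z.2.2.2, z.1, z.2.1)) ?_ ?_ ?_ ?_ ?_ <;> simp
    _ = 0 := by simp [hentry, hpair]

/-- Construction IV, part 2: if `C_i ⊆ C_{s+1-i}^{⊥σ'}` for all `i`, then
`[C_1, …, C_s]·(π_e(A)⁻¹·Q·D⁻¹) ⊆ C(A)^{⊥σ}`; if moreover `π_e(A)·A = Q·D⁻¹`, then `C(A)`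
is `σ` self-orthogonal. -/
theorem stmt10 {p h : ℕ} (hp : p.Prime) (hh : 0 < h)
    {F : Type} [Field F] [Fintype F] [DecidableEq F] (hcard : Fintype.card F = p ^ h)
    (e : ℕ) (he : e < h)
    {n s : ℕ} (C : Fin s → Submodule F (Fin n → F))
    (A : Matrix (Fin s) (Fin s) F) (hAdet : IsUnit A.det) (hT : IsToeplitz A)
    (Mτ' : Matrix (Fin n) (Fin n) F) (hMτ' : IsMonomial Mτ')
    (D : Fin s → F) (hD : ∀ i, D i ≠ 0)
    (hnest : ∀ i : Fin s, C i ≤ sigmaDual p e Mτ' (C i.rev)) :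
    matrixProductCode C ((piE p e A)⁻¹ * antiDiagQ F s * (Matrix.diagonal D)⁻¹) ≤
      sigmaDual p e (Matrix.diagonal D ⊗ₖ Mτ') (matrixProductCode C A) ∧
    (piE p e A * A = antiDiagQ F s * (Matrix.diagonal D)⁻¹ →
      matrixProductCode C A ≤
        sigmaDual p e (Matrix.diagonal D ⊗ₖ Mτ') (matrixProductCode C A)) := by
  have : Fact p.Prime := ⟨hp⟩
  have : CharP F p := charP_of_card_eq_prime_pow hcard
  have hunit := isUnit_det_piE p e hAdet
  have hDunit : IsUnit (Matrix.diagonal D).det := by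
    rw [Matrix.det_diagonal, isUnit_iff_ne_zero]
    exact Finset.prod_ne_zero_iff.mpr fun i _ => hD i
  have hle := matrixProductCode_le_sigmaDual p e C A
    ((piE p e A)⁻¹ * antiDiagQ F s * (Matrix.diagonal D)⁻¹) Mτ' D hnest (by
      rw [Matrix.nonsing_inv_mul_cancel_right _ _ hDunit, Matrix.mul_assoc,
        (hT.piE p e).antiDiagQ_mul_transpose, Matrix.nonsing_inv_mul_cancel_left _ _ hunit])
  refine ⟨hle, fun hA => ?_⟩
  rwa [Matrix.mul_assoc, ← hA, Matrix.nonsing_inv_mul_cancel_left _ _ hunit] at hle
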